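/- Let L be a restricted Lie algebra over a field F of characteristic p > 0. Then L is finite-dimensional and p-nilpotent if and only if the augmentation ideal ω(L) of u(L) is a nilpotent (associative) ideal. -/

import Mathlib

open UniversalEnvelopingAlgebra

attribute [local instance 100] LieRing.ofAssociativeRing

/-- A restricted Lie algebra over a field `F` of characteristic `p`: a Lie algebra equipped
with a `p`-map `x ↦ x^[p]` satisfying Jacobson's identities.  The additive identity
`(x+y)^[p] = x^[p] + y^[p] + Σ sᵢ(x,y)` (with `sᵢ` the Jacobson polynomials) is expressed
faithfully inside the universal enveloping algebra, where it reads
`ι((x+y)^[p]) - ι(x^[p]) - ι(y^[p]) = (ι x + ι y)^p - (ι x)^p - (ι y)^p`. -/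
class RestrictedLieAlgebra (p : ℕ) (F : Type*) (L : Type*) [Field F]
    [LieRing L] [LieAlgebra F L] : Type _ where
  pOp : L → L
  pOp_smul : ∀ (a : F) (x : L), pOp (a • x) = a ^ p • pOp x
  ad_pOp : ∀ x y : L, ⁅pOp x, y⁆ = ((LieAlgebra.ad F L x) ^ p) y
  pOp_add : ∀ x y : L,
    ι F (pOp (x + y)) - ι F (pOp x) - ι F (pOp y)
      = (ι F x + ι F y) ^ p - (ι F x) ^ p - (ι F y) ^ p

namespace RestrictedLieAlgebra

variable (p : ℕ) (F : Type*) [Field F]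

section Defs

variable (L : Type*) [LieRing L] [LieAlgebra F L] [RestrictedLieAlgebra p F L]

/-- The `p`-map of a restricted Lie algebra. -/
abbrev pmap (x : L) : L := RestrictedLieAlgebra.pOp (p := p) (F := F) x

/-- The relation defining the restricted enveloping algebra as a quotient of the
universal enveloping algebra: `x^p = x^[p]` for all `x ∈ L`. -/
def uRel : UniversalEnvelopingAlgebra F L → UniversalEnvelopingAlgebra F L → Prop :=
  fun a b => ∃ x : L, a = (ι F x) ^ p ∧ b = ι F (pmap p F L x)

/-- The restricted enveloping algebra `u(L)`: the quotient of the universal enveloping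
algebra of `L` by the two-sided ideal generated by `{x^p - x^[p] : x ∈ L}`. -/
abbrev uEnv := RingQuot (uRel p F L)

/-- The canonical (linear) embedding `L → u(L)`. -/
def uemb : L →ₗ[F] uEnv p F L :=
  ((RingQuot.mkAlgHom F (uRel p F L)).toLinearMap).comp (ι F : L →ₗ⁅F⁆ _).toLinearMap

variable [Fact p.Prime]

/-- The augmentation map `ε : u(L) → F`, induced by `x ↦ 0` for `x ∈ L`. -/
noncomputable def aug : uEnv p F L →ₐ[F] F :=
  RingQuot.liftAlgHom F
    ⟨(UniversalEnvelopingAlgebra.lift F) (0 : L →ₗ⁅F⁆ F), by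
      rintro a b ⟨x, rfl, rfl⟩
      simp [UniversalEnvelopingAlgebra.lift_ι_apply,
        zero_pow (Nat.Prime.ne_zero (Fact.out : p.Prime))]⟩

/-- The augmentation ideal `ω(L)`, i.e. the kernel of the augmentation map, as a
subspace of `u(L)`. -/
noncomputable def omegaIdeal : Submodule F (uEnv p F L) :=
  LinearMap.ker (aug p F L).toLinearMap

/-- The image of `L` inside `u(L)`. -/
def lSub : Submodule F (uEnv p F L) := LinearMap.range (uemb p F L)

end Defs

section Closure

variable {L : Type*} [LieRing L] [LieAlgebra F L] [RestrictedLieAlgebra p F L]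

/-- The restricted subalgebra generated by a subset `S` of `L`: the smallest Lie
subalgebra containing `S` which is closed under the `p`-map. -/
def restrictedClosure (S : Set L) : LieSubalgebra F L :=
  sInf {K : LieSubalgebra F L | S ⊆ K ∧ ∀ x ∈ K, pmap p F L x ∈ K}

/-- For a subalgebra `N ⊆ L`, the restricted subalgebra `N^p` generated by all
`x^[p]`, `x ∈ N`. -/
def subPPow (K : LieSubalgebra F L) : LieSubalgebra F L :=
  restrictedClosure p F (pmap p F L '' K)

end Closure

section PNilpotent

variable (L : Type*) [LieRing L] [LieAlgebra F L] [RestrictedLieAlgebra p F L]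

/-- `L` is `p`-nilpotent if `L^{pˢ} = 0` for some `s`, where `L^p` denotes the restricted
subalgebra generated by all `x^[p]`. -/
def IsPNilpotent : Prop :=
  ∃ s : ℕ, (subPPow p F)^[s] (⊤ : LieSubalgebra F L) = ⊥

/-- The derived subalgebra `L' = γ₂(L)` as a submodule of `L`. -/
abbrev derivedSub : Submodule F L := (LieModule.lowerCentralSeries F L L 1).toSubmodule

/-- `L'_p`, the restricted subalgebra generated by `L'`, as a submodule. -/
def derivedP : Submodule F L :=
  (restrictedClosure p F (derivedSub F L : Set L)).toSubmodule

/-- `L'^p + γ₃(L)`, as a submodule of `L`. -/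
def mainIdeal : Submodule F L :=
  (subPPow p F (restrictedClosure p F (derivedSub F L : Set L))).toSubmodule
    ⊔ (LieModule.lowerCentralSeries F L L 2).toSubmodule

end PNilpotent

end RestrictedLieAlgebra

namespace MvPolynomial

variable (I F : Type*) [Field F]

/-- The span of the monomials of degree strictly less than `d`. -/
noncomputable def degLT (d : ℕ) : Submodule F (MvPolynomial I F) :=
  Submodule.span F ((fun a => monomial a (1 : F)) '' {a : I →₀ ℕ | a.degree < d})

variable {I F}

theorem monomial_mem_degLT {a : I →₀ ℕ} {d : ℕ} (h : a.degree < d) :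
    monomial a (1 : F) ∈ degLT I F d :=
  Submodule.subset_span ⟨a, h, rfl⟩

theorem degLT_mono {d e : ℕ} (h : d ≤ e) : degLT I F d ≤ degLT I F e :=
  Submodule.span_mono (Set.image_mono fun _ ha => lt_of_lt_of_le ha h)

@[simp]
theorem degLT_zero : degLT I F 0 = ⊥ := by simp [degLT]

theorem degLT_le_iff {d : ℕ} {N : Submodule F (MvPolynomial I F)} :
    degLT I F d ≤ N ↔ ∀ a : I →₀ ℕ, a.degree < d → monomial a (1 : F) ∈ N := by
  rw [degLT, Submodule.span_le, Set.image_subset_iff]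
  rfl

theorem exists_mem_degLT (f : MvPolynomial I F) : ∃ d, f ∈ degLT I F d := by
  induction f using MvPolynomial.induction_on'' with
  | C r =>
    refine ⟨1, ?_⟩
    have := (degLT I F 1).smul_mem r (monomial_mem_degLT (a := (0 : I →₀ ℕ)) (by simp))
    rwa [smul_monomial, smul_eq_mul, mul_one] at this
  | monomial_add a b f _ _ hf hb =>
    obtain ⟨d, hd⟩ := hf
    obtain ⟨e, he⟩ := hb
    exact ⟨max d e, add_mem (degLT_mono (le_max_right _ _) he) (degLT_mono (le_max_left _ _) hd)⟩
  | mul_X f i hf =>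
    obtain ⟨d, hd⟩ := hf
    refine ⟨d + 1, ?_⟩
    have : degLT I F d ≤ (degLT I F (d + 1)).comap (LinearMap.mulRight F (X i)) := by
      rw [degLT_le_iff]
      intro a ha
      simp only [Submodule.mem_comap, LinearMap.mulRight_apply, X, monomial_mul, mul_one]
      exact monomial_mem_degLT (by simpa using ha)
    exact this hd

theorem coeff_eq_zero_of_mem_degLT {f : MvPolynomial I F} {d : ℕ} (hf : f ∈ degLT I F d)
    {a : I →₀ ℕ} (ha : d ≤ a.degree) : coeff a f = 0 := by
  classical
  have : degLT I F d ≤ LinearMap.ker (lcoeff F a) := by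
    rw [degLT_le_iff]
    intro c hc
    have hne : c ≠ a := by rintro rfl; omega
    simp [coeff_monomial, hne]
  exact this hf

theorem mul_mem_degLT {f g : MvPolynomial I F} {d e : ℕ} (hf : f ∈ degLT I F (d + 1))
    (hg : g ∈ degLT I F e) : f * g ∈ degLT I F (d + e) := by
  have h : degLT I F (d + 1) * degLT I F e ≤ degLT I F (d + e) := by
    rw [degLT, degLT, Submodule.span_mul_span, Submodule.span_le]
    rintro _ ⟨_, ⟨a, ha, rfl⟩, _, ⟨c, hc, rfl⟩, rfl⟩
    simp only [Set.mem_ofPred_eq] at ha hc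
    simp only [monomial_mul, mul_one]
    refine monomial_mem_degLT ?_
    simp only [map_add]
    omega
  exact h (Submodule.mul_mem_mul hf hg)

theorem X_mem_degLT (i : I) : (X i : MvPolynomial I F) ∈ degLT I F 2 :=
  monomial_mem_degLT (by simp)

theorem X_mul_mem_degLT {f : MvPolynomial I F} {d : ℕ} (hf : f ∈ degLT I F d) (i : I) :
    X i * f ∈ degLT I F (d + 1) := by
  have := mul_mem_degLT (X_mem_degLT i) hf
  rwa [add_comm] at this

/-- The endomorphism `E` of the polynomial ring has order at most `k`, and agrees with the
multiplication by `g` up to terms of lower degree. -/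
structure HasSymbol (E : Module.End F (MvPolynomial I F)) (k : ℕ) (g : MvPolynomial I F) :
    Prop where
  symbol_mem : g ∈ degLT I F (k + 1)
  sub_mem : ∀ (d : ℕ) (f : MvPolynomial I F), f ∈ degLT I F (d + 1) →
    E f - g * f ∈ degLT I F (d + k)

namespace HasSymbol

variable {E E' : Module.End F (MvPolynomial I F)} {k k' : ℕ} {g g' : MvPolynomial I F}

theorem apply_mem (h : HasSymbol E k g) {d : ℕ} {f : MvPolynomial I F} (hf : f ∈ degLT I F d) :
    E f ∈ degLT I F (d + k) := by
  cases d with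
  | zero =>
    have : f = 0 := by simpa using hf
    simp [this]
  | succ d =>
    rw [← sub_add_cancel (E f) (g * f)]
    refine add_mem (degLT_mono (by omega) (h.sub_mem d f hf)) ?_
    exact degLT_mono (by omega) (mul_mem_degLT h.symbol_mem hf)

theorem one : HasSymbol (1 : Module.End F (MvPolynomial I F)) 0 1 :=
  ⟨monomial_mem_degLT (a := 0) (by simp), fun d f _ => by simp⟩

theorem mul (h : HasSymbol E k g) (h' : HasSymbol E' k' g') :
    HasSymbol (E * E') (k + k') (g * g') where
  symbol_mem := degLT_mono (by omega) (mul_mem_degLT h.symbol_mem h'.symbol_mem)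
  sub_mem d f hf := by
    have h1 := h.apply_mem (h'.sub_mem d f hf)
    have h2 := h.sub_mem _ _ (degLT_mono (e := d + k' + 1) (by omega)
      (mul_mem_degLT h'.symbol_mem hf))
    have h3 := add_mem (degLT_mono (e := d + (k + k')) (by omega) h1)
      (degLT_mono (e := d + (k + k')) (by omega) h2)
    convert h3 using 1
    simp only [Module.End.mul_apply, map_sub]
    ring

theorem pow (h : HasSymbol E k g) (n : ℕ) : HasSymbol (E ^ n) (n * k) (g ^ n) := by
  induction n with
  | zero => simpa using one
  | succ n ih => simpa [pow_succ, add_mul] using ih.mul h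

theorem add (h : HasSymbol E k g) (h' : HasSymbol E' k g') :
    HasSymbol (E + E') k (g + g') where
  symbol_mem := add_mem h.symbol_mem h'.symbol_mem
  sub_mem d f hf := by
    convert add_mem (h.sub_mem d f hf) (h'.sub_mem d f hf) using 1
    simp only [LinearMap.add_apply]
    ring

theorem smul (h : HasSymbol E k g) (c : F) : HasSymbol (c • E) k (c • g) where
  symbol_mem := Submodule.smul_mem _ _ h.symbol_mem
  sub_mem d f hf := by
    convert Submodule.smul_mem _ c (h.sub_mem d f hf) using 1
    simp [smul_sub]

theorem zero (k : ℕ) : HasSymbol (0 : Module.End F (MvPolynomial I F)) k 0 :=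
  ⟨zero_mem _, fun d f _ => by simp⟩

theorem sub_of_lt (h : HasSymbol E k g) (h' : HasSymbol E' k' g') (hk : k' < k) :
    HasSymbol (E - E') k g where
  symbol_mem := h.symbol_mem
  sub_mem d f hf := by
    convert _root_.sub_mem (h.sub_mem d f hf) (degLT_mono (e := d + k) (by omega) (h'.apply_mem hf))
      using 1
    simp only [LinearMap.sub_apply]
    ring

end HasSymbol

end MvPolynomial

namespace LieAlgebra.PBW

open MvPolynomial

variable {F L I : Type*} [Field F] [LieRing L] [LieAlgebra F L] [LinearOrder I]

/-- `j` and `t` split off the smallest index of the exponent `a`, and this index is less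
than `i`. -/
def IsSplit (i : I) (a : I →₀ ℕ) (j : I) (t : I →₀ ℕ) : Prop :=
  a = Finsupp.single j 1 + t ∧ j < i ∧ ∀ k ∈ t.support, j ≤ k

theorem exists_isSplit {i : I} {a : I →₀ ℕ} (h : ¬∀ k ∈ a.support, i ≤ k) :
    ∃ jt : I × (I →₀ ℕ), IsSplit i a jt.1 jt.2 := by
  push Not at h
  obtain ⟨k, hk, hki⟩ := h
  have hne : a.support.Nonempty := ⟨k, hk⟩
  have hmem := a.support.min'_mem hne
  refine ⟨(a.support.min' hne, a - Finsupp.single (a.support.min' hne) 1), ?_,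
    lt_of_le_of_lt (a.support.min'_le k hk) hki, ?_⟩
  · rw [add_tsub_cancel_of_le]
    rw [Finsupp.single_le_iff]
    exact Nat.one_le_iff_ne_zero.mpr (Finsupp.mem_support_iff.mp hmem)
  · intro l hl
    exact a.support.min'_le l (Finsupp.support_tsub hl)

theorem IsSplit.unique {i : I} {a : I →₀ ℕ} {j j' : I} {t t' : I →₀ ℕ} (h : IsSplit i a j t)
    (h' : IsSplit i a j' t') : j = j' ∧ t = t' := by
  obtain ⟨rfl, -, hj⟩ := h
  obtain ⟨e, -, hj'⟩ := h'
  have key : ∀ {j j' : I} {t t' : I →₀ ℕ}, Finsupp.single j 1 + t = Finsupp.single j' 1 + t' →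
      (∀ k ∈ t'.support, j' ≤ k) → j' ≤ j := by
    intro j j' t t' e hj'
    by_cases hjj : j = j'
    · exact hjj.ge
    · refine hj' j ?_
      have := DFunLike.congr_fun e j
      simp only [Finsupp.add_apply, Finsupp.single_eq_same,
        Finsupp.single_eq_of_ne (show j ≠ j' from hjj)] at this
      rw [Finsupp.mem_support_iff]
      omega
  have hjj : j = j' := le_antisymm (key e.symm hj) (key e hj')
  subst hjj
  exact ⟨rfl, add_left_cancel e⟩

theorem IsSplit.not_forall_le {i : I} {a : I →₀ ℕ} {j : I} {t : I →₀ ℕ} (h : IsSplit i a j t) :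
    ¬∀ k ∈ a.support, i ≤ k := by
  intro hle
  refine absurd (hle j ?_) (not_le.mpr h.2.1)
  rw [h.1, Finsupp.mem_support_iff]
  simp

theorem IsSplit.degree_eq {i : I} {a : I →₀ ℕ} {j : I} {t : I →₀ ℕ} (h : IsSplit i a j t) :
    a.degree = t.degree + 1 := by
  rw [h.1, map_add, Finsupp.degree_single, add_comm]

open Classical in
/-- The action of a basis element on a monomial, given an action on monomials of smaller
degree. -/
noncomputable def actStep (b : Module.Basis I F L)
    (A : L →ₗ[F] MvPolynomial I F →ₗ[F] MvPolynomial I F) (i : I) (a : I →₀ ℕ) :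
    MvPolynomial I F :=
  if h : ∃ jt : I × (I →₀ ℕ), IsSplit i a jt.1 jt.2 then
    X i * monomial a 1
      + A (b h.choose.1) (A (b i) (monomial h.choose.2 1) - X i * monomial h.choose.2 1)
      + A ⁅b i, b h.choose.1⁆ (monomial h.choose.2 1)
  else X i * monomial a 1

/-- Approximations to the action of a Lie algebra on the polynomial ring over a basis; the
`n`-th one is the correct one in degrees at most `n`. -/
noncomputable def actAux (b : Module.Basis I F L) :
    ℕ → L →ₗ[F] MvPolynomial I F →ₗ[F] MvPolynomial I F
  | 0 => b.constr F fun i => LinearMap.mulLeft F (X i)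
  | n + 1 => b.constr F fun i => (basisMonomials I F).constr F (actStep b (actAux b n) i)

variable (b : Module.Basis I F L)

theorem actStep_of_forall_le (A : L →ₗ[F] MvPolynomial I F →ₗ[F] MvPolynomial I F) {i : I}
    {a : I →₀ ℕ} (h : ∀ k ∈ a.support, i ≤ k) : actStep b A i a = X i * monomial a 1 :=
  dif_neg fun ⟨_, hs⟩ => hs.not_forall_le h

theorem actStep_of_isSplit (A : L →ₗ[F] MvPolynomial I F →ₗ[F] MvPolynomial I F) {i j : I}
    {a t : I →₀ ℕ} (h : IsSplit i a j t) :
    actStep b A i a = X i * monomial a 1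
      + A (b j) (A (b i) (monomial t 1) - X i * monomial t 1) + A ⁅b i, b j⁆ (monomial t 1) := by
  have hex : ∃ jt : I × (I →₀ ℕ), IsSplit i a jt.1 jt.2 := ⟨(j, t), h⟩
  obtain ⟨hj, ht⟩ := hex.choose_spec.unique h
  rw [actStep, dif_pos hex, hj, ht]

theorem actAux_succ_apply (n : ℕ) (i : I) (a : I →₀ ℕ) :
    actAux b (n + 1) (b i) (monomial a 1) = actStep b (actAux b n) i a := by
  have := (basisMonomials I F).constr_basis F (actStep b (actAux b n) i) a
  rw [coe_basisMonomials] at this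
  rw [actAux, Module.Basis.constr_basis, this]

/-- Bilinear statements about vectors of degree less than `d` may be checked on a basis. -/
theorem mem_of_basis {F L I : Type*} [Field F] [LieRing L] [LieAlgebra F L]
    {b : Module.Basis I F L} {V : Type*} [AddCommGroup V] [Module F V] {N : Submodule F V} {d : ℕ}
    (A : L →ₗ[F] MvPolynomial I F →ₗ[F] V)
    (h : ∀ (i : I) (a : I →₀ ℕ), a.degree < d → A (b i) (monomial a 1) ∈ N)
    (y : L) {f : MvPolynomial I F} (hf : f ∈ degLT I F d) : A y f ∈ N := by
  have h1 : ∀ i, degLT I F d ≤ N.comap (A (b i)) := fun i => degLT_le_iff.mpr (h i)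
  have h2 : (⊤ : Submodule F L) ≤ N.comap (A.flip f) := by
    rw [← b.span_eq, Submodule.span_le]
    rintro _ ⟨i, rfl⟩
    exact h1 i hf
  exact h2 (Submodule.mem_top (x := y))

theorem actAux_sub_mem (n : ℕ) : ∀ (i : I) (a : I →₀ ℕ), a.degree ≤ n →
    actAux b n (b i) (monomial a 1) - X i * monomial a 1 ∈ degLT I F (a.degree + 1) := by
  induction n with
  | zero => intro i a _; simp [actAux]
  | succ n ih =>
    have hmap : ∀ d ≤ n + 1, ∀ (y : L) (f : MvPolynomial I F), f ∈ degLT I F d →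
        actAux b n y f ∈ degLT I F (d + 1) := by
      intro d hd y f hf
      refine mem_of_basis (b := b) (actAux b n) (fun i a ha => ?_) y hf
      rw [← sub_add_cancel (actAux b n (b i) (monomial a 1)) (X i * monomial a 1)]
      exact add_mem (degLT_mono (by omega) (ih i a (by omega)))
        (X_mul_mem_degLT (monomial_mem_degLT ha) i)
    intro i a ha
    rw [actAux_succ_apply]
    by_cases h : ∀ k ∈ a.support, i ≤ k
    · simp [actStep_of_forall_le b _ h]
    · obtain ⟨⟨j, t⟩, hs⟩ := exists_isSplit h
      have hdeg : a.degree = t.degree + 1 := hs.degree_eq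
      rw [actStep_of_isSplit b _ hs, add_assoc, add_sub_cancel_left, hdeg]
      refine add_mem (hmap _ (by omega) _ _ (ih i t (by omega))) ?_
      exact hmap _ (by omega) _ _ (monomial_mem_degLT (Nat.lt_succ_self _))

theorem actAux_succ_eq (n : ℕ) : ∀ (y : L) (f : MvPolynomial I F), f ∈ degLT I F (n + 1) →
    actAux b (n + 1) y f = actAux b n y f := by
  have reduce : ∀ m, (∀ (i : I) (a : I →₀ ℕ), a.degree < m + 1 →
      actAux b (m + 1) (b i) (monomial a 1) = actAux b m (b i) (monomial a 1)) →
      ∀ (y : L) (f : MvPolynomial I F), f ∈ degLT I F (m + 1) →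
        actAux b (m + 1) y f = actAux b m y f := by
    intro m h y f hf
    have := mem_of_basis (b := b) (N := ⊥) (actAux b (m + 1) - actAux b m)
      (fun i a ha => by simp [h i a ha]) y hf
    simpa [sub_eq_zero] using this
  induction n with
  | zero =>
    refine reduce 0 fun i a ha => ?_
    have : a = 0 := by simpa [Finsupp.degree_eq_zero_iff] using ha
    subst this
    rw [actAux_succ_apply, actStep_of_forall_le b _ (by simp)]
    simp [actAux]
  | succ n ih =>
    refine reduce (n + 1) fun i a ha => ?_
    rw [actAux_succ_apply, actAux_succ_apply]
    by_cases h : ∀ k ∈ a.support, i ≤ k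
    · rw [actStep_of_forall_le b _ h, actStep_of_forall_le b _ h]
    · obtain ⟨⟨j, t⟩, hs⟩ := exists_isSplit h
      have hdeg : a.degree = t.degree + 1 := hs.degree_eq
      have ht : (monomial t (1 : F)) ∈ degLT I F (n + 1) := monomial_mem_degLT (by omega)
      rw [actStep_of_isSplit b _ hs, actStep_of_isSplit b _ hs, ih _ _ ht, ih _ _ ht, ih]
      exact degLT_mono (by omega) (actAux_sub_mem b n i t (by omega))

/-- The action of a Lie algebra on the polynomial ring over a basis. -/
noncomputable def act : L →ₗ[F] MvPolynomial I F →ₗ[F] MvPolynomial I F :=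
  b.constr F fun i => (basisMonomials I F).constr F
    fun a => actAux b a.degree (b i) (monomial a 1)

theorem actAux_eq_act {n : ℕ} (y : L) {f : MvPolynomial I F} (hf : f ∈ degLT I F (n + 1)) :
    actAux b n y f = act b y f := by
  have := mem_of_basis (b := b) (N := ⊥) (actAux b n - act b) (fun i a ha => ?_) y hf
  · simpa [sub_eq_zero] using this
  have h1 := (basisMonomials I F).constr_basis F
    (fun a => actAux b a.degree (b i) (monomial a 1)) a
  rw [coe_basisMonomials] at h1
  have h2 : ∀ k, actAux b (a.degree + k) (b i) (monomial a 1)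
      = actAux b a.degree (b i) (monomial a 1) := by
    intro k
    induction k with
    | zero => rfl
    | succ k ih =>
      rw [← ih, ← add_assoc]
      exact actAux_succ_eq b _ _ _ (monomial_mem_degLT (by omega))
  obtain ⟨k, rfl⟩ := Nat.exists_eq_add_of_le (Nat.lt_succ_iff.mp ha)
  rw [Submodule.mem_bot, LinearMap.sub_apply, LinearMap.sub_apply, sub_eq_zero, h2, act,
    Module.Basis.constr_basis, h1]

theorem act_of_forall_le {i : I} {a : I →₀ ℕ} (h : ∀ k ∈ a.support, i ≤ k) :
    act b (b i) (monomial a 1) = X i * monomial a 1 := by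
  rw [← actAux_eq_act b (n := a.degree + 1) _ (monomial_mem_degLT (by omega)),
    actAux_succ_apply, actStep_of_forall_le b _ h]

theorem hasSymbol_act_basis (i : I) : HasSymbol (act b (b i)) 1 (X i) where
  symbol_mem := X_mem_degLT i
  sub_mem d f hf := by
    have : degLT I F (d + 1) ≤
        (degLT I F (d + 1)).comap (act b (b i) - LinearMap.mulLeft F (X i)) := by
      rw [degLT_le_iff]
      intro a ha
      have h := actAux_sub_mem b a.degree i a le_rfl
      rw [actAux_eq_act b _ (monomial_mem_degLT (by omega))] at h
      simpa using degLT_mono (by omega) h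
    simpa using this hf

theorem hasSymbol_act (y : L) : HasSymbol (act b y) 1 (b.constr F (fun i => X i) y) := by
  induction b.mem_span y using Submodule.span_induction with
  | mem _ h =>
    obtain ⟨i, rfl⟩ := h
    simpa [Module.Basis.constr_basis] using hasSymbol_act_basis b i
  | zero => simpa using HasSymbol.zero 1
  | add x y _ _ hx hy => simpa using hx.add hy
  | smul c x _ hx => simpa using hx.smul c

theorem act_act_of_lt {i j : I} {t : I →₀ ℕ} (hji : j < i) (ht : ∀ k ∈ t.support, j ≤ k) :
    act b (b i) (act b (b j) (monomial t 1)) =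
      act b (b j) (act b (b i) (monomial t 1)) + act b ⁅b i, b j⁆ (monomial t 1) := by
  have hX : ∀ (k : I) (s : I →₀ ℕ), (X k * monomial s 1 : MvPolynomial I F)
      = monomial (Finsupp.single k 1 + s) 1 := fun k s => by rw [X, monomial_mul, one_mul]
  have hs : IsSplit i (Finsupp.single j 1 + t) j t := ⟨rfl, hji, ht⟩
  have hdeg := hs.degree_eq
  have hmt : monomial t (1 : F) ∈ degLT I F (t.degree + 1) := monomial_mem_degLT (by omega)
  have hsub : act b (b i) (monomial t 1) - X i * monomial t 1 ∈ degLT I F (t.degree + 1) :=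
    (hasSymbol_act_basis b i).sub_mem _ _ hmt
  have hle : ∀ k ∈ (Finsupp.single i 1 + t).support, j ≤ k := by
    intro k hk
    by_cases hki : k = i
    · exact hki ▸ hji.le
    · refine ht k ?_
      simpa [Finsupp.single_eq_of_ne (show k ≠ i from hki)] using hk
  rw [act_of_forall_le b ht, hX,
    ← actAux_eq_act b (n := t.degree + 1) (b i) (monomial_mem_degLT (by omega)),
    actAux_succ_apply, actStep_of_isSplit b _ hs, actAux_eq_act b _ hmt, actAux_eq_act b _ hmt,
    actAux_eq_act b _ hsub, map_sub, hX i t, act_of_forall_le b hle, hX, hX, add_left_comm]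
  abel

theorem act_lie_of_mem (n : ℕ) : ∀ (x y : L) (f : MvPolynomial I F), f ∈ degLT I F n →
    act b x (act b y f) = act b y (act b x f) + act b ⁅x, y⁆ f := by
  induction n with
  | zero =>
    intro x y f hf
    have : f = 0 := by simpa using hf
    simp [this]
  | succ n ih =>
    have key : ∀ (i j : I) (t : I →₀ ℕ), t.degree < n + 1 →
        act b (b i) (act b (b j) (monomial t 1)) =
          act b (b j) (act b (b i) (monomial t 1)) + act b ⁅b i, b j⁆ (monomial t 1) := by
      intro i j t ht
      rcases eq_or_ne i j with rfl | hij
      · simp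
      by_cases h : ∀ k ∈ t.support, min i j ≤ k
      · rcases lt_or_gt_of_ne hij with hlt | hlt
        · rw [min_eq_left hlt.le] at h
          rw [act_act_of_lt b hlt h, ← lie_skew (b i) (b j), map_neg, LinearMap.neg_apply]
          abel
        · rw [min_eq_right hlt.le] at h
          exact act_act_of_lt b hlt h
      · obtain ⟨⟨k, s⟩, hs⟩ := exists_isSplit h
        have hdeg := hs.degree_eq
        obtain ⟨hts, hk, hks⟩ := hs
        simp only at hts hk hks hdeg
        subst hts
        have hms : monomial s (1 : F) ∈ degLT I F n := monomial_mem_degLT (by omega)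
        have hkt : monomial (Finsupp.single k 1 + s) (1 : F) = act b (b k) (monomial s 1) := by
          rw [act_of_forall_le b hks, X, monomial_mul, one_mul]
        -- commute `b k` past `b l` on `b m • s`
        have hcomm : ∀ l m : I, k < l → k < m →
            act b (b l) (act b (b k) (act b (b m) (monomial s 1))) =
              act b (b k) (act b (b l) (act b (b m) (monomial s 1)))
                + act b ⁅b l, b k⁆ (act b (b m) (monomial s 1)) := by
          intro l m hl hm
          have hsub : act b (b m) (monomial s 1) - X m * monomial s 1 ∈ degLT I F n :=
            degLT_mono (by omega) ((hasSymbol_act_basis b m).sub_mem s.degree _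
              (monomial_mem_degLT (by omega)))
          have hle : ∀ r ∈ (Finsupp.single m 1 + s).support, k ≤ r := by
            intro r hr
            by_cases hrm : r = m
            · exact hrm ▸ hm.le
            · refine hks r ?_
              simpa [Finsupp.single_eq_of_ne (show r ≠ m from hrm)] using hr
          have e1 := ih (b l) (b k) _ hsub
          have e2 := act_act_of_lt b hl hle
          rw [show monomial (Finsupp.single m 1 + s) (1 : F) = X m * monomial s 1 by
            rw [X, monomial_mul, one_mul]] at e2
          rw [← sub_add_cancel (act b (b m) (monomial s 1)) (X m * monomial s 1)]
          simp only [map_add, e1, e2]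
          abel
        have hki : k < i := lt_of_lt_of_le hk (min_le_left _ _)
        have hkj : k < j := lt_of_lt_of_le hk (min_le_right _ _)
        have hjac : ⁅⁅b i, b j⁆, b k⁆ = ⁅b i, ⁅b j, b k⁆⁆ - ⁅b j, ⁅b i, b k⁆⁆ := lie_lie _ _ _
        rw [hkt, ih (b j) (b k) _ hms, ih (b i) (b k) _ hms, ih ⁅b i, b j⁆ (b k) _ hms, map_add,
          map_add, hcomm i j hki hkj, hcomm j i hkj hki, ih (b i) (b j) _ hms,
          ih (b i) ⁅b j, b k⁆ _ hms, ih (b j) ⁅b i, b k⁆ _ hms, hjac]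
        simp only [map_add, map_sub, LinearMap.sub_apply]
        abel
    intro x y f hf
    have hxy : ∀ i, ∀ y : L, act b (b i) (act b y f) =
        act b y (act b (b i) f) + act b ⁅b i, y⁆ f := by
      intro i y
      have := mem_of_basis (b := b) (N := ⊥) (d := n + 1)
        ((act b).compr₂ (act b (b i)) - (act b).compl₂ (act b (b i))
          - (act b).comp (LieAlgebra.ad F L (b i))) (fun j t ht => by simp [key i j t ht]) y hf
      simpa [sub_eq_zero, sub_sub] using this
    induction b.mem_span x using Submodule.span_induction with
    | mem _ h =>
      obtain ⟨i, rfl⟩ := h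
      exact hxy i y
    | zero => simp
    | add x x' _ _ hx hx' => simp only [map_add, LinearMap.add_apply, hx, hx', add_lie]; abel
    | smul c x _ hx => simp only [map_smul, LinearMap.smul_apply, hx, smul_lie, smul_add]

/-- The representation of a Lie algebra on the polynomial ring over a basis. -/
noncomputable def rep : L →ₗ⁅F⁆ Module.End F (MvPolynomial I F) :=
  { act b with
    map_lie' := by
      intro x y
      refine LinearMap.ext fun f => ?_
      obtain ⟨n, hn⟩ := exists_mem_degLT f
      have := act_lie_of_mem b n x y f hn
      simp [LieRing.of_associative_ring_bracket, this] }

theorem hasSymbol_rep (y : L) : HasSymbol (rep b y) 1 (b.constr F (fun i => X i) y) :=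
  hasSymbol_act b y

end LieAlgebra.PBW

namespace UniversalEnvelopingAlgebra

theorem adjoin_range_ι (F L : Type*) [CommRing F] [LieRing L] [LieAlgebra F L] :
    Algebra.adjoin F (Set.range (ι F : L → UniversalEnvelopingAlgebra F L)) = ⊤ := by
  have h : Function.Surjective (mkAlgHom F L) := RingCon.mkₐ_surjective _
  have h2 : Set.range (ι F : L → UniversalEnvelopingAlgebra F L) =
      mkAlgHom F L '' Set.range (TensorAlgebra.ι F) := by
    rw [← Set.range_comp]
    rfl
  rw [h2, ← AlgHom.map_adjoin, TensorAlgebra.adjoin_range_ι, Algebra.map_top,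
    AlgHom.range_eq_top]
  exact h

instance (F L : Type*) [Field F] [LieRing L] [LieAlgebra F L] :
    Nontrivial (UniversalEnvelopingAlgebra F L) :=
  (lift F (0 : L →ₗ⁅F⁆ F)).toRingHom.domain_nontrivial

end UniversalEnvelopingAlgebra

/-- In an algebra of characteristic `p`, `(ad a)^p = ad (a^p)`. -/
theorem LieAlgebra.ad_pow_char_apply (p : ℕ) {F A : Type*} [Field F] [Fact p.Prime] [CharP F p]
    [Ring A] [Nontrivial A] [Algebra F A] (a c : A) :
    ((LieAlgebra.ad F A a) ^ p) c = a ^ p * c - c * a ^ p := by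
  have : CharP (Module.End F A) p := charP_of_injective_algebraMap' F p
  have h : LieAlgebra.ad F A a = LinearMap.mulLeft F a - LinearMap.mulRight F a := by
    ext c
    simp [LieRing.of_associative_ring_bracket]
  rw [h, sub_pow_char_of_commute p (LinearMap.commute_mulLeft_right a a),
    LinearMap.pow_mulLeft, LinearMap.pow_mulRight]
  simp

namespace RestrictedLieAlgebra

open MvPolynomial LieAlgebra.PBW

section PCenter

variable (p : ℕ) (F : Type*) {L : Type*} [Field F] [LieRing L] [LieAlgebra F L]
  [RestrictedLieAlgebra p F L]

/-- The element `x^p - x^[p]` of the universal enveloping algebra. -/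
noncomputable def pDiff (x : L) : UniversalEnvelopingAlgebra F L :=
  ι F x ^ p - ι F (pmap p F L x)

theorem pDiff_add (x y : L) : pDiff p F (x + y) = pDiff p F x + pDiff p F y := by
  have h := RestrictedLieAlgebra.pOp_add (p := p) (F := F) x y
  rw [sub_sub, sub_sub, sub_eq_sub_iff_sub_eq_sub] at h
  simp only [pDiff, pmap, map_add]
  rw [← neg_sub, h]
  abel

theorem pDiff_smul (c : F) (x : L) : pDiff p F (c • x) = c ^ p • pDiff p F x := by
  simp only [pDiff, pmap, RestrictedLieAlgebra.pOp_smul, map_smul, smul_pow, smul_sub]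

variable [Fact p.Prime]

theorem pmap_zero : pmap p F L 0 = 0 := by
  have h := RestrictedLieAlgebra.pOp_smul (p := p) (0 : F) (0 : L)
  simpa [zero_pow (Fact.out : p.Prime).ne_zero] using h

theorem pDiff_zero : pDiff p F (0 : L) = 0 := by
  simp [pDiff, pmap_zero, zero_pow (Fact.out : p.Prime).ne_zero]

theorem pDiff_mem_center [CharP F p] (x : L) :
    pDiff p F x ∈ Subalgebra.center F (UniversalEnvelopingAlgebra F L) := by
  have hgen : ∀ y : L, Commute (pDiff p F x) (ι F y) := by
    intro y
    have h1 : ∀ n : ℕ, ι F (((LieAlgebra.ad F L x) ^ n) y)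
        = ((LieAlgebra.ad F (UniversalEnvelopingAlgebra F L) (ι F x)) ^ n) (ι F y) := by
      intro n
      induction n with
      | zero => rfl
      | succ n ih =>
        rw [pow_succ', pow_succ', Module.End.mul_apply, Module.End.mul_apply, ← ih,
          LieAlgebra.ad_apply, LieAlgebra.ad_apply, LieHom.map_lie]
    have h2 := h1 p
    rw [← RestrictedLieAlgebra.ad_pOp, LieHom.map_lie, LieRing.of_associative_ring_bracket,
      LieAlgebra.ad_pow_char_apply p] at h2
    rw [commute_iff_eq, pDiff, sub_mul, mul_sub, sub_eq_sub_iff_sub_eq_sub]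
    exact h2.symm
  have htop : (⊤ : Subalgebra F (UniversalEnvelopingAlgebra F L)) ≤
      Subalgebra.centralizer F {pDiff p F x} := by
    rw [← UniversalEnvelopingAlgebra.adjoin_range_ι, Algebra.adjoin_le_iff]
    rintro _ ⟨y, rfl⟩
    rw [SetLike.mem_coe, Subalgebra.mem_centralizer_iff]
    rintro _ rfl
    exact hgen y
  rw [Subalgebra.mem_center_iff]
  intro u
  exact ((Subalgebra.mem_centralizer_iff F).mp (htop (Algebra.mem_top (x := u))) _ rfl).symm

end PCenter

section Quotient

variable (p : ℕ) {F L I : Type*} [Field F] [Fact p.Prime] [LieRing L]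
  [LieAlgebra F L] [RestrictedLieAlgebra p F L] [LinearOrder I] (b : Module.Basis I F L)

/-- The action of `U(L)` on the polynomial ring over a basis of `L`. -/
noncomputable def uaAct :
    UniversalEnvelopingAlgebra F L →ₐ[F] Module.End F (MvPolynomial I F) :=
  UniversalEnvelopingAlgebra.lift F (rep b)

theorem uaAct_ι (x : L) : uaAct b (ι F x) = rep b x :=
  UniversalEnvelopingAlgebra.lift_ι_apply F (rep b) x

/-- The subspace spanned by the images of the central elements `x^p - x^[p]`. -/
noncomputable def pRange : Submodule F (MvPolynomial I F) :=
  ⨆ i, LinearMap.range (uaAct b (pDiff p F (b i)))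

theorem hasSymbol_pDiff (i : I) : HasSymbol (uaAct b (pDiff p F (b i))) p (X i ^ p) := by
  have h := (hasSymbol_rep b (b i)).pow p
  rw [mul_one, Module.Basis.constr_basis] at h
  rw [pDiff, map_sub, map_pow, uaAct_ι, uaAct_ι]
  exact h.sub_of_lt (hasSymbol_rep b _) (Fact.out : p.Prime).one_lt

theorem pDiff_apply_mem_pRange (x : L) (f : MvPolynomial I F) :
    uaAct b (pDiff p F x) f ∈ pRange p b := by
  induction b.mem_span x using Submodule.span_induction with
  | mem _ h =>
    obtain ⟨i, rfl⟩ := h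
    exact Submodule.mem_iSup_of_mem i ⟨f, rfl⟩
  | zero => simp [pDiff_zero]
  | add x y _ _ hx hy =>
    rw [pDiff_add, map_add]
    exact add_mem hx hy
  | smul c x _ hx =>
    rw [pDiff_smul, map_smul]
    exact Submodule.smul_mem _ _ hx

variable [CharP F p]

/-- The polynomials in the central elements `(b i)^p - (b i)^[p]`. -/
noncomputable def pCenterHom :
    MvPolynomial I F →ₐ[F] Subalgebra.center F (UniversalEnvelopingAlgebra F L) :=
  aeval fun i => ⟨pDiff p F (b i), pDiff_mem_center p F (b i)⟩

theorem hasSymbol_pCenterHom (c : I →₀ ℕ) :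
    HasSymbol (uaAct b (pCenterHom p b (monomial c 1))) (p * c.degree)
      (monomial (p • c) 1) := by
  induction c using Finsupp.induction_linear with
  | zero => simpa using HasSymbol.one
  | add c c' hc hc' =>
    have := hc.mul hc'
    rw [monomial_mul, one_mul, ← smul_add, ← mul_add, ← map_add, ← map_mul, ← Subalgebra.coe_mul,
      ← map_mul, monomial_mul, one_mul] at this
    exact this
  | single i n =>
    have := (hasSymbol_pDiff p b i).pow n
    rw [← map_pow, ← pow_mul, X_pow_eq_monomial] at this
    rw [← X_pow_eq_monomial, map_pow, Finsupp.degree_single, Finsupp.smul_single, smul_eq_mul,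
      mul_comm p n]
    rw [mul_comm p n] at this
    simpa [pCenterHom] using this

/-- The monomial basis of the polynomial ring, modified so that `(b i)^p - (b i)^[p]` acts by
adding `p` to the `i`-th exponent. -/
noncomputable def pMonomial (a : I →₀ ℕ) : MvPolynomial I F :=
  uaAct b (pCenterHom p b (monomial (a.mapRange (· / p) (Nat.zero_div p)) 1))
    (monomial (a.mapRange (· % p) (Nat.zero_mod p)) 1)

theorem pMonomial_sub_mem (a : I →₀ ℕ) :
    pMonomial p b a - monomial a 1 ∈ degLT I F a.degree := by
  have ha : p • a.mapRange (· / p) (Nat.zero_div p) + a.mapRange (· % p) (Nat.zero_mod p) = a := by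
    ext i
    simp [Nat.div_add_mod]
  have h := (hasSymbol_pCenterHom p b (a.mapRange (· / p) (Nat.zero_div p))).sub_mem _ _
    (monomial_mem_degLT (a := a.mapRange (· % p) (Nat.zero_mod p)) (Nat.lt_succ_self _))
  have hdeg := congrArg Finsupp.degree ha
  rw [map_add, map_nsmul, smul_eq_mul, add_comm] at hdeg
  rwa [monomial_mul, one_mul, ha, hdeg] at h

theorem pMonomial_add_single (a : I →₀ ℕ) (i : I) :
    pMonomial p b (Finsupp.single i p + a) = uaAct b (pDiff p F (b i)) (pMonomial p b a) := by
  have hp : 0 < p := (Fact.out : p.Prime).pos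
  have h1 : (Finsupp.single i p + a).mapRange (· / p) (Nat.zero_div p) =
      Finsupp.single i 1 + a.mapRange (· / p) (Nat.zero_div p) := by
    ext j
    by_cases hj : j = i
    · subst hj
      simp [Nat.add_div_left _ hp, add_comm]
    · simp [Finsupp.single_eq_of_ne (show j ≠ i from hj)]
  have h2 : (Finsupp.single i p + a).mapRange (· % p) (Nat.zero_mod p) =
      a.mapRange (· % p) (Nat.zero_mod p) := by
    ext j
    by_cases hj : j = i
    · subst hj
      simp
    · simp [Finsupp.single_eq_of_ne (show j ≠ i from hj)]
  have h3 : (monomial (Finsupp.single i 1 + a.mapRange (· / p) (Nat.zero_div p)) 1 :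
      MvPolynomial I F) = X i * monomial (a.mapRange (· / p) (Nat.zero_div p)) 1 := by
    rw [X, monomial_mul, one_mul]
  rw [pMonomial, h1, h2, h3, map_mul, Subalgebra.coe_mul, map_mul, pMonomial,
    Module.End.mul_apply]
  simp [pCenterHom]

/-- The change of basis from monomials to modified monomials. -/
noncomputable def pChange : Module.End F (MvPolynomial I F) :=
  (basisMonomials I F).constr F (pMonomial p b)

theorem pChange_monomial (a : I →₀ ℕ) : pChange p b (monomial a 1) = pMonomial p b a := by
  have := (basisMonomials I F).constr_basis F (pMonomial p b) a
  rwa [coe_basisMonomials] at this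

theorem pChange_sub_mem {f : MvPolynomial I F} {d : ℕ} (hf : f ∈ degLT I F (d + 1)) :
    pChange p b f - f ∈ degLT I F d := by
  have h : degLT I F (d + 1) ≤ (degLT I F d).comap (pChange p b - 1) := by
    rw [degLT_le_iff]
    intro a ha
    simpa [pChange_monomial] using
      degLT_mono (Nat.lt_succ_iff.mp ha) (pMonomial_sub_mem p b a)
  exact h hf

theorem pChange_surjective : Function.Surjective (pChange p b) := by
  have h : ∀ d, degLT I F d ≤ LinearMap.range (pChange p b) := by
    intro d
    induction d with
    | zero => simp
    | succ d ih =>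
      intro f hf
      rw [← sub_sub_cancel (pChange p b f) f]
      exact sub_mem (LinearMap.mem_range_self _ _) (ih (pChange_sub_mem p b hf))
  intro f
  obtain ⟨d, hd⟩ := exists_mem_degLT f
  exact h d hd

theorem pChange_X_pow_mul (i : I) (f : MvPolynomial I F) :
    pChange p b (X i ^ p * f) = uaAct b (pDiff p F (b i)) (pChange p b f) := by
  have h : pChange p b ∘ₗ LinearMap.mulLeft F (X i ^ p) =
      uaAct b (pDiff p F (b i)) ∘ₗ pChange p b := by
    refine (basisMonomials I F).ext fun a => ?_
    simp only [coe_basisMonomials, LinearMap.comp_apply, LinearMap.mulLeft_apply]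
    rw [X_pow_eq_monomial, monomial_mul, one_mul, pChange_monomial, pChange_monomial,
      pMonomial_add_single]
  exact LinearMap.congr_fun h f

theorem pRange_le_map :
    pRange p b ≤ (⨆ i, LinearMap.range (LinearMap.mulLeft F (X i ^ p : MvPolynomial I F))).map
      (pChange p b) := by
  refine iSup_le fun i => ?_
  rintro _ ⟨f, rfl⟩
  obtain ⟨g, rfl⟩ := pChange_surjective p b f
  rw [← pChange_X_pow_mul]
  exact Submodule.mem_map_of_mem (Submodule.mem_iSup_of_mem i ⟨g, rfl⟩)

theorem mem_degLT_of_pChange_mem {g : MvPolynomial I F} {d : ℕ}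
    (h : pChange p b g ∈ degLT I F d) : g ∈ degLT I F d := by
  obtain ⟨e, he⟩ := exists_mem_degLT g
  obtain ⟨k, hk⟩ : ∃ k, g ∈ degLT I F (d + k) := ⟨e, degLT_mono (by omega) he⟩
  clear he
  induction k with
  | zero => exact hk
  | succ k ih =>
    refine ih ?_
    rw [← sub_sub_cancel (pChange p b g) g]
    exact sub_mem (degLT_mono (by omega) h) (pChange_sub_mem p b hk)

/-- The leading restricted monomials of an element of `pRange` vanish. -/
theorem coeff_eq_zero_of_mem_pRange {f : MvPolynomial I F} (hf : f ∈ pRange p b)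
    {a : I →₀ ℕ} (ha : ∀ i, a i < p) (hdeg : f ∈ degLT I F (a.degree + 1)) : coeff a f = 0 := by
  obtain ⟨g, hg, rfl⟩ := pRange_le_map p b hf
  have hle : (⨆ i, LinearMap.range (LinearMap.mulLeft F (X i ^ p : MvPolynomial I F))) ≤
      LinearMap.ker (lcoeff F a) := by
    refine iSup_le fun i => ?_
    rintro _ ⟨h, rfl⟩
    have : ¬Finsupp.single i p ≤ a := by
      rw [Finsupp.single_le_iff]
      exact not_le.mpr (ha i)
    simp [X_pow_eq_monomial, coeff_monomial_mul', this]
  have h1 : coeff a g = 0 := hle hg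
  have h2 := coeff_eq_zero_of_mem_degLT
    (pChange_sub_mem p b (mem_degLT_of_pChange_mem p b hdeg)) le_rfl
  rwa [coeff_sub, h1, sub_zero] at h2

theorem pRange_le_comap (x : L) : pRange p b ≤ (pRange p b).comap (rep b x) := by
  refine iSup_le fun i => ?_
  rintro _ ⟨f, rfl⟩
  have h := (Subalgebra.mem_center_iff.mp (pDiff_mem_center p F (b i)) (ι F x))
  rw [Submodule.mem_comap, ← uaAct_ι, ← Module.End.mul_apply, ← map_mul, h, map_mul]
  exact pDiff_apply_mem_pRange p b _ _

/-- The restricted representation of `L` on the quotient of the polynomial ring by the image of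
the elements `x^p - x^[p]`. -/
noncomputable def quotRep : L →ₗ⁅F⁆ Module.End F (MvPolynomial I F ⧸ pRange p b) where
  toFun x := (pRange p b).mapQ (pRange p b) (rep b x) (pRange_le_comap p b x)
  map_add' x y := by
    refine Submodule.linearMap_qext _ (LinearMap.ext fun f => ?_)
    simp
  map_smul' c x := by
    refine Submodule.linearMap_qext _ (LinearMap.ext fun f => ?_)
    simp
  map_lie' {x y} := by
    refine Submodule.linearMap_qext _ (LinearMap.ext fun f => ?_)
    simp [LieRing.of_associative_ring_bracket]

theorem quotRep_mk (x : L) (f : MvPolynomial I F) :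
    quotRep p b x (Submodule.Quotient.mk f) = Submodule.Quotient.mk (rep b x f) := rfl

theorem quotRep_pow (x : L) : quotRep p b x ^ p = quotRep p b (pmap p F L x) := by
  refine Submodule.linearMap_qext _ (LinearMap.ext fun f => ?_)
  have h : ∀ n : ℕ, (quotRep p b x ^ n) (Submodule.Quotient.mk f) =
      Submodule.Quotient.mk ((rep b x ^ n) f) := by
    intro n
    induction n with
    | zero => rfl
    | succ n ih =>
      rw [pow_succ', Module.End.mul_apply, ih, quotRep_mk, pow_succ', Module.End.mul_apply]
  simp only [LinearMap.comp_apply, Submodule.mkQ_apply]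
  rw [h, quotRep_mk, Submodule.Quotient.eq, ← uaAct_ι, ← uaAct_ι, ← map_pow,
    ← LinearMap.sub_apply, ← map_sub]
  exact pDiff_apply_mem_pRange p b x f

/-- The representation of the restricted enveloping algebra induced by `quotRep`. -/
noncomputable def uAct : uEnv p F L →ₐ[F] Module.End F (MvPolynomial I F ⧸ pRange p b) :=
  RingQuot.liftAlgHom F ⟨UniversalEnvelopingAlgebra.lift F (quotRep p b), by
    rintro _ _ ⟨x, rfl, rfl⟩
    rw [map_pow, UniversalEnvelopingAlgebra.lift_ι_apply,
      UniversalEnvelopingAlgebra.lift_ι_apply, quotRep_pow]⟩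

theorem uAct_uemb (x : L) : uAct p b (uemb p F L x) = quotRep p b x := by
  rw [uAct, uemb, LinearMap.comp_apply, AlgHom.toLinearMap_apply,
    RingQuot.liftAlgHom_mkAlgHom_apply]
  exact UniversalEnvelopingAlgebra.lift_ι_apply F _ x

theorem uAct_prod_mk (l : List L) (f : MvPolynomial I F) :
    uAct p b (l.map (uemb p F L)).prod (Submodule.Quotient.mk f) =
      Submodule.Quotient.mk ((l.map (rep b)).prod f) := by
  induction l with
  | nil => simp
  | cons x l ih =>
    simp only [List.map_cons, List.prod_cons, map_mul, Module.End.mul_apply, ih, uAct_uemb,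
      quotRep_mk]

/-- Products of distinct basis elements are nonzero in the restricted enveloping algebra. -/
theorem prod_uemb_ne_zero {l : List I} (hl : l.Nodup) :
    (l.map fun i => uemb p F L (b i)).prod ≠ 0 := by
  classical
  intro h0
  have h := uAct_prod_mk p b (l.map b) 1
  rw [List.map_map, List.map_map] at h
  simp only [Function.comp_def, h0, map_zero, LinearMap.zero_apply] at h
  have hmem := (Submodule.Quotient.mk_eq_zero _).mp h.symm
  have hsym : HasSymbol (l.map fun i => rep b (b i)).prod l.length
      (monomial (l.map fun i => Finsupp.single i 1).sum 1) := by
    clear hl h0 h hmem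
    induction l with
    | nil => simpa using HasSymbol.one
    | cons i l ih =>
      have hi := hasSymbol_rep b (b i)
      rw [Module.Basis.constr_basis] at hi
      have := hi.mul ih
      rw [X, monomial_mul, one_mul, add_comm 1] at this
      simpa using this
  have hdeg : (l.map fun i => Finsupp.single i 1).sum.degree = l.length := by
    clear hl h0 h hmem hsym
    induction l with
    | nil => simp
    | cons i l ih => simp [ih, add_comm]
  have hres : ∀ j, (l.map fun i => Finsupp.single i 1).sum j < p := by
    intro j
    have : (l.map fun i => Finsupp.single i 1).sum j = l.count j := by
      clear hl h0 h hmem hsym hdeg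
      induction l with
      | nil => simp
      | cons i l ih =>
        simp [ih, List.count_cons, Finsupp.single_apply, add_comm]
    rw [this]
    exact lt_of_le_of_lt (List.nodup_iff_count_le_one.mp hl j) (Fact.out : p.Prime).one_lt
  have h1 : (1 : MvPolynomial I F) ∈ degLT I F 1 := HasSymbol.one.symbol_mem
  have h2 := coeff_eq_zero_of_mem_degLT (hsym.sub_mem 0 1 h1)
    (a := (l.map fun i => Finsupp.single i 1).sum) (by rw [hdeg, zero_add])
  have h3 := coeff_eq_zero_of_mem_pRange p b hmem hres
    (by rw [hdeg, add_comm]; exact hsym.apply_mem h1)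
  rw [mul_one, coeff_sub, h3, coeff_monomial, if_pos rfl] at h2
  simp at h2

end Quotient

theorem uemb_injective (p : ℕ) (F L : Type*) [Field F] [Fact p.Prime] [CharP F p] [LieRing L]
    [LieAlgebra F L] [RestrictedLieAlgebra p F L] : Function.Injective (uemb p F L) := by
  classical
  let b := Module.Basis.ofVectorSpace F L
  let _ : LinearOrder (Module.Basis.ofVectorSpaceIndex F L) :=
    IsWellOrder.linearOrder WellOrderingRel
  rw [injective_iff_map_eq_zero]
  intro x hx
  have h := uAct_prod_mk p b [x] 1
  simp only [List.map_cons, List.map_nil, List.prod_cons, List.prod_nil, mul_one, hx, map_zero,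
    LinearMap.zero_apply] at h
  have hmem : rep b x 1 ∈ pRange p b := (Submodule.Quotient.mk_eq_zero _).mp h.symm
  have h1 : (1 : MvPolynomial (Module.Basis.ofVectorSpaceIndex F L) F) ∈ degLT _ F 1 :=
    HasSymbol.one.symbol_mem
  have hcoeff : ∀ (y : L) (i : Module.Basis.ofVectorSpaceIndex F L),
      coeff (Finsupp.single i 1) (b.constr F
        (fun i => (X i : MvPolynomial (Module.Basis.ofVectorSpaceIndex F L) F)) y) = b.repr y i := by
    intro y i
    induction b.mem_span y using Submodule.span_induction with
    | mem _ h =>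
      obtain ⟨j, rfl⟩ := h
      rw [Module.Basis.constr_basis, coeff_X, b.repr_self, Finsupp.single_apply]
      simp [Finsupp.single_left_inj]
    | zero => simp
    | add x y _ _ hx hy => simp [hx, hy]
    | smul c x _ hx => simp [hx]
  refine b.repr.map_eq_zero_iff.mp (Finsupp.ext fun i => ?_)
  have h2 := coeff_eq_zero_of_mem_degLT ((hasSymbol_rep b x).sub_mem 0 1 h1)
    (a := Finsupp.single i 1) (by simp)
  have h3 := coeff_eq_zero_of_mem_pRange p b hmem (a := Finsupp.single i 1)
    (fun j => lt_of_le_of_lt (by rw [Finsupp.single_apply]; split_ifs <;> simp)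
      (Fact.out : p.Prime).one_lt)
    (by simpa using (hasSymbol_rep b x).apply_mem h1)
  rw [mul_one, coeff_sub, h3, zero_sub, neg_eq_zero, hcoeff] at h2
  simpa using h2

section Omega

variable (p : ℕ) (F L : Type*) [Field F] [LieRing L] [LieAlgebra F L]
  [RestrictedLieAlgebra p F L]

theorem uemb_pow (x : L) : uemb p F L x ^ p = uemb p F L (pmap p F L x) := by
  have h := RingQuot.mkAlgHom_rel F (s := uRel p F L) ⟨x, rfl, rfl⟩
  rw [map_pow] at h
  exact h

/-- The embedding of `L` into `u(L)` as a morphism of Lie algebras. -/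
def uembHom : L →ₗ⁅F⁆ uEnv p F L :=
  (RingQuot.mkAlgHom F (uRel p F L)).toLieHom.comp (ι F)

theorem uembHom_apply (x : L) : uembHom p F L x = uemb p F L x := rfl

theorem adjoin_range_uemb : Algebra.adjoin F (Set.range (uemb p F L)) = ⊤ := by
  have h2 : Set.range (uemb p F L) = RingQuot.mkAlgHom F (uRel p F L) '' Set.range (ι F) := by
    rw [← Set.range_comp]
    rfl
  rw [h2, ← AlgHom.map_adjoin, UniversalEnvelopingAlgebra.adjoin_range_ι, Algebra.map_top,
    AlgHom.range_eq_top]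
  exact RingQuot.mkAlgHom_surjective F _

theorem mem_one_sup_lSub_mul_top (u : uEnv p F L) : u ∈ 1 ⊔ lSub p F L * ⊤ := by
  have hu : u ∈ Algebra.adjoin F (Set.range (uemb p F L)) := by
    rw [adjoin_range_uemb]
    exact Algebra.mem_top
  induction hu using Algebra.adjoin_induction with
  | mem x hx =>
    refine Submodule.mem_sup_right ?_
    rw [← mul_one x]
    exact Submodule.mul_mem_mul hx Submodule.mem_top
  | algebraMap c => exact Submodule.mem_sup_left (Submodule.algebraMap_mem c)
  | add u v _ _ hu hv => exact add_mem hu hv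
  | mul u v _ _ hu hv =>
    obtain ⟨_, hc, k, hk, rfl⟩ := Submodule.mem_sup.mp hu
    obtain ⟨c, rfl⟩ := Submodule.mem_one.mp hc
    rw [add_mul, ← Algebra.smul_def]
    refine add_mem (Submodule.smul_mem _ _ hv) (Submodule.mem_sup_right ?_)
    have := Submodule.mul_mem_mul hk (Submodule.mem_top (R := F) (x := v))
    rw [mul_assoc] at this
    have hle : lSub p F L * (⊤ * ⊤) ≤ lSub p F L * ⊤ := mul_le_mul' le_rfl le_top
    exact hle this

theorem iterate_pmap_mem (s : ℕ) (x : L) :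
    (pmap p F L)^[s] x ∈ (subPPow p F)^[s] (⊤ : LieSubalgebra F L) := by
  induction s with
  | zero => exact LieSubalgebra.mem_top x
  | succ s ih =>
    rw [Function.iterate_succ_apply', Function.iterate_succ_apply', subPPow, restrictedClosure,
      ← SetLike.mem_coe, LieSubalgebra.coe_sInf]
    simp only [Set.mem_iInter]
    exact fun K hK => hK.1 ⟨_, ih, rfl⟩

theorem uemb_pow_iterate (s : ℕ) (x : L) :
    uemb p F L x ^ p ^ s = uemb p F L ((pmap p F L)^[s] x) := by
  induction s with
  | zero => simp
  | succ s ih => rw [pow_succ, pow_mul, ih, uemb_pow, Function.iterate_succ_apply']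

variable [Fact p.Prime]

theorem aug_uemb (x : L) : aug p F L (uemb p F L x) = 0 := by
  rw [aug, uemb, LinearMap.comp_apply, AlgHom.toLinearMap_apply,
    RingQuot.liftAlgHom_mkAlgHom_apply]
  exact UniversalEnvelopingAlgebra.lift_ι_apply F (0 : L →ₗ⁅F⁆ F) x

theorem uemb_mem_omegaIdeal (x : L) : uemb p F L x ∈ omegaIdeal p F L := aug_uemb p F L x

theorem omegaIdeal_le : omegaIdeal p F L ≤ lSub p F L * ⊤ := by
  intro u hu
  obtain ⟨_, hc, k, hk, rfl⟩ := Submodule.mem_sup.mp (mem_one_sup_lSub_mul_top p F L u)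
  obtain ⟨c, rfl⟩ := Submodule.mem_one.mp hc
  have hle : lSub p F L * ⊤ ≤ omegaIdeal p F L := by
    rw [Submodule.mul_le]
    rintro _ ⟨x, rfl⟩ v -
    change aug p F L _ = 0
    rw [map_mul, aug_uemb, zero_mul]
  have h1 : aug p F L (algebraMap F _ c + k) = 0 := hu
  have h2 : aug p F L k = 0 := hle hk
  rw [map_add, h2, add_zero, AlgHom.commutes] at h1
  have h3 : c = 0 := h1
  rwa [h3, map_zero, zero_add]

theorem top_mul_omegaIdeal_pow_mul_top_le (k : ℕ) :
    ⊤ * (omegaIdeal p F L ^ k * ⊤) ≤ omegaIdeal p F L ^ k * ⊤ := by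
  cases k with
  | zero =>
    rw [pow_zero, one_mul]
    exact le_top
  | succ k =>
    have h : ⊤ * omegaIdeal p F L ≤ omegaIdeal p F L := by
      rw [Submodule.mul_le]
      intro u _ v hv
      have hv' : aug p F L v = 0 := hv
      change aug p F L _ = 0
      rw [map_mul, hv', mul_zero]
    rw [pow_succ', mul_assoc, ← mul_assoc]
    exact mul_le_mul' h le_rfl

variable {p F L}

theorem exists_omegaIdeal_pow_eq_bot [FiniteDimensional F L] (h : IsPNilpotent p F L) :
    ∃ n : ℕ, omegaIdeal p F L ^ n = ⊥ := by
  obtain ⟨s, hs⟩ := h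
  let φ : L →ₗ⁅F⁆ Module.End F (uEnv p F L) :=
    (Algebra.lmul F (uEnv p F L)).toLieHom.comp (uembHom p F L)
  let _ : LieRingModule L (uEnv p F L) := LieRingModule.compLieHom (uEnv p F L) φ
  have : LieModule F L (uEnv p F L) := LieModule.compLieHom (uEnv p F L) φ
  have hbr : ∀ (x : L) (v : uEnv p F L), ⁅x, v⁆ = uemb p F L x * v := fun _ _ => rfl
  have hnil : ∀ x : L, IsNilpotent (LieModule.toEnd F L (uEnv p F L) x) := by
    intro x
    have hx := iterate_pmap_mem p F L s x
    rw [hs, LieSubalgebra.mem_bot] at hx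
    have he : LieModule.toEnd F L (uEnv p F L) x = Algebra.lmul F _ (uemb p F L x) := by
      ext v
      exact hbr x v
    refine ⟨p ^ s, ?_⟩
    rw [he, ← map_pow, uemb_pow_iterate, hx, map_zero, map_zero]
  have hE : LieModule.IsNilpotent L (uEnv p F L) :=
    LieAlgebra.isEngelian_of_isNoetherian _ hnil
  obtain ⟨k, hk⟩ := (LieModule.isNilpotent_iff F L (uEnv p F L)).mp hE
  have hle : ∀ n, omegaIdeal p F L ^ n * ⊤ ≤
      (LieModule.lowerCentralSeries F L (uEnv p F L) n).toSubmodule := by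
    intro n
    induction n with
    | zero => simp
    | succ n ih =>
      rw [pow_succ', mul_assoc]
      refine (mul_le_mul' (omegaIdeal_le p F L) le_rfl).trans ?_
      rw [mul_assoc]
      refine (mul_le_mul' le_rfl
        ((top_mul_omegaIdeal_pow_mul_top_le p F L n).trans ih)).trans ?_
      rw [Submodule.mul_le]
      rintro _ ⟨x, rfl⟩ v hv
      rw [LieModule.lowerCentralSeries_succ, ← hbr]
      exact LieSubmodule.lie_mem_lie (LieSubmodule.mem_top x) hv
  refine ⟨k, (Submodule.eq_bot_iff _).mpr fun u hu => ?_⟩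
  have := hle k (Submodule.mul_mem_mul hu (Submodule.mem_top (x := 1)))
  rw [hk] at this
  simpa using this

theorem mul_mem_omegaIdeal_pow {u v : uEnv p F L} {m n : ℕ} (hu : u ∈ omegaIdeal p F L ^ m)
    (hv : v ∈ omegaIdeal p F L ^ n) : u * v ∈ omegaIdeal p F L ^ (m + n) := by
  rw [pow_add]
  exact Submodule.mul_mem_mul hu hv

theorem omegaIdeal_pow_antitone {m n : ℕ} (hm : 0 < m) (h : m ≤ n) :
    omegaIdeal p F L ^ n ≤ omegaIdeal p F L ^ m := by
  have hsq : omegaIdeal p F L * omegaIdeal p F L ≤ omegaIdeal p F L := by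
    rw [Submodule.mul_le]
    intro u hu v _
    have hu' : aug p F L u = 0 := hu
    change aug p F L _ = 0
    rw [map_mul, hu', zero_mul]
  induction n, h using Nat.le_induction with
  | base => exact le_rfl
  | succ n hn ih =>
    refine le_trans ?_ ih
    obtain ⟨k, rfl⟩ : ∃ k, n = k + 1 := ⟨n - 1, by omega⟩
    rw [pow_succ, pow_succ, mul_assoc]
    exact mul_le_mul' le_rfl hsq

/-- The elements of `L` lying in a positive power of the augmentation ideal. -/
noncomputable def dimensionSubalgebra (p : ℕ) (F L : Type*) [Field F] [LieRing L] [LieAlgebra F L]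
    [RestrictedLieAlgebra p F L] [Fact p.Prime] (k : ℕ) : LieSubalgebra F L :=
  { (omegaIdeal p F L ^ (k + 1)).comap (uemb p F L) with
    lie_mem' := by
      intro x y hx hy
      have hle := omegaIdeal_pow_antitone (p := p) (F := F) (L := L)
        (Nat.succ_pos k) (Nat.le_add_right (k + 1) (k + 1))
      change uemb p F L ⁅x, y⁆ ∈ omegaIdeal p F L ^ (k + 1)
      rw [← uembHom_apply, LieHom.map_lie, LieRing.of_associative_ring_bracket]
      exact sub_mem (hle (mul_mem_omegaIdeal_pow hx hy)) (hle (mul_mem_omegaIdeal_pow hy hx)) }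

theorem mem_dimensionSubalgebra {k : ℕ} {x : L} :
    x ∈ dimensionSubalgebra p F L k ↔ uemb p F L x ∈ omegaIdeal p F L ^ (k + 1) := Iff.rfl

theorem uemb_pmap_mem {k : ℕ} {x : L} (hx : x ∈ dimensionSubalgebra p F L k) :
    uemb p F L (pmap p F L x) ∈ omegaIdeal p F L ^ ((k + 1) * p) := by
  rw [← uemb_pow, pow_mul]
  exact Submodule.pow_mem_pow _ hx p

theorem subPPow_le_dimensionSubalgebra (s : ℕ) :
    (subPPow p F)^[s] (⊤ : LieSubalgebra F L) ≤ dimensionSubalgebra p F L s := by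
  have hp : 2 ≤ p := (Fact.out : p.Prime).two_le
  induction s with
  | zero =>
    intro x _
    rw [mem_dimensionSubalgebra, zero_add, pow_one]
    exact uemb_mem_omegaIdeal p F L x
  | succ s ih =>
    rw [Function.iterate_succ_apply', subPPow, restrictedClosure]
    refine sInf_le ⟨?_, fun x hx => ?_⟩
    · rintro _ ⟨x, hx, rfl⟩
      exact omegaIdeal_pow_antitone (Nat.succ_pos (s + 1)) (by nlinarith) (uemb_pmap_mem (ih hx))
    · exact omegaIdeal_pow_antitone (Nat.succ_pos (s + 1)) (by nlinarith) (uemb_pmap_mem hx)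

theorem isPNilpotent_of_omegaIdeal_pow_eq_bot [CharP F p] {n : ℕ}
    (h : omegaIdeal p F L ^ n = ⊥) : IsPNilpotent p F L := by
  refine ⟨n, (LieSubalgebra.eq_bot_iff _).mpr fun x hx => ?_⟩
  have hx' := mem_dimensionSubalgebra.mp (subPPow_le_dimensionSubalgebra n hx)
  rw [pow_succ, h, Submodule.bot_mul, Submodule.mem_bot] at hx'
  exact (map_eq_zero_iff _ (uemb_injective p F L)).mp hx'

theorem finiteDimensional_of_omegaIdeal_pow_eq_bot [CharP F p] {n : ℕ}
    (h : omegaIdeal p F L ^ n = ⊥) : FiniteDimensional F L := by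
  let b := Module.Basis.ofVectorSpace F L
  let _ : LinearOrder (Module.Basis.ofVectorSpaceIndex F L) :=
    IsWellOrder.linearOrder WellOrderingRel
  rcases finite_or_infinite (Module.Basis.ofVectorSpaceIndex F L) with hfin | hinf
  · exact Module.Finite.of_basis b
  obtain ⟨s, hs⟩ := Infinite.exists_subset_card_eq (Module.Basis.ofVectorSpaceIndex F L) n
  refine absurd ?_ (prod_uemb_ne_zero p b s.nodup_toList)
  have hmem : ∀ l : List (Module.Basis.ofVectorSpaceIndex F L),
      (l.map fun i => uemb p F L (b i)).prod ∈ omegaIdeal p F L ^ l.length := by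
    intro l
    induction l with
    | nil => exact Submodule.one_le.mp le_rfl
    | cons i l ih =>
      rw [List.map_cons, List.prod_cons, List.length_cons, pow_succ']
      exact Submodule.mul_mem_mul (uemb_mem_omegaIdeal p F L _) ih
  have := hmem s.toList
  rwa [Finset.length_toList, hs, h, Submodule.mem_bot] at this

end Omega

end RestrictedLieAlgebra

open RestrictedLieAlgebra in
/-- `L` is finite-dimensional and `p`-nilpotent if and only if the augmentation ideal
`ω(L)` of `u(L)` is nilpotent. -/
theorem pnilpotent_iff_omega_nilpotent
    (p : ℕ) (F L : Type*) [Field F] [Fact p.Prime] [CharP F p]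
    [LieRing L] [LieAlgebra F L] [RestrictedLieAlgebra p F L] :
    (FiniteDimensional F L ∧ IsPNilpotent p F L) ↔
      ∃ n : ℕ, (omegaIdeal p F L) ^ n = ⊥ := by
  constructor
  · rintro ⟨hfin, hnil⟩
    exact exists_omegaIdeal_pow_eq_bot hnil
  · rintro ⟨n, hn⟩
    exact ⟨finiteDimensional_of_omegaIdeal_pow_eq_bot hn, isPNilpotent_of_omegaIdeal_pow_eq_bot hn⟩
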